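/- Extended Pythagorean theorem along geodesics: let F : ℝ^D → ℝ be differentiable and let θ_p, θ_q, θ_r ∈ ℝ^D satisfy the orthogonality condition ⟨θ_p − θ_q, ∇F(θ_r) − ∇F(θ_q)⟩ = 0. Then for all t, t′ ∈ (0,1), setting θ_t := (1 − t)·θ_p + t·θ_q (a point on the primal geodesic from p to q), and for any point s ∈ ℝ^D with ∇F(s) = (1 − t′)·∇F(θ_q) + t′·∇F(θ_r) (a point on the dual geodesic from q to r), one has B_F(θ_t : θ_q) + B_F(θ_q : s) = B_F(θ_t : s). -/

import Mathlib

open RealInnerProductSpace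

/-- The Bregman divergence of a differentiable generator `F`:
`B_F(θ₁ : θ₂) = F(θ₁) − F(θ₂) − ⟨θ₁ − θ₂, ∇F(θ₂)⟩`. -/
noncomputable def bregman {D : ℕ} (F : EuclideanSpace ℝ (Fin D) → ℝ)
    (θ₁ θ₂ : EuclideanSpace ℝ (Fin D)) : ℝ :=
  F θ₁ - F θ₂ - ⟪θ₁ - θ₂, gradient F θ₂⟫

/-- The three-point identity for Bregman divergences. -/
theorem bregman_add_bregman {D : ℕ} (F : EuclideanSpace ℝ (Fin D) → ℝ)
    (a b c : EuclideanSpace ℝ (Fin D)) :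
    bregman F a b + bregman F b c =
      bregman F a c + ⟪a - b, gradient F c - gradient F b⟫ := by
  simp only [bregman, inner_sub_left, inner_sub_right]
  ring

/-- Extended Pythagorean theorem along geodesics: under the orthogonality condition
`⟨θ_p − θ_q, ∇F(θ_r) − ∇F(θ_q)⟩ = 0`, for all `t, t′ ∈ (0,1)`, the point
`θ_t = (1−t)θ_p + tθ_q` on the primal geodesic from `p` to `q` and any point `s` on the
dual geodesic from `q` to `r` (i.e. with `∇F(s) = (1−t′)∇F(θ_q) + t′∇F(θ_r)`) satisfy
`B_F(θ_t : θ_q) + B_F(θ_q : s) = B_F(θ_t : s)`. -/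
theorem extended_pythagorean_theorem {D : ℕ}
    (F : EuclideanSpace ℝ (Fin D) → ℝ) (hF : Differentiable ℝ F)
    (θp θq θr : EuclideanSpace ℝ (Fin D))
    (horth : ⟪θp - θq, gradient F θr - gradient F θq⟫ = 0)
    (t t' : ℝ) (ht : t ∈ Set.Ioo (0 : ℝ) 1) (ht' : t' ∈ Set.Ioo (0 : ℝ) 1)
    (s : EuclideanSpace ℝ (Fin D))
    (hs : gradient F s = (1 - t') • gradient F θq + t' • gradient F θr) :
    bregman F ((1 - t) • θp + t • θq) θq + bregman F θq s =
      bregman F ((1 - t) • θp + t • θq) s := by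
  have hθ : (1 - t) • θp + t • θq - θq = (1 - t) • (θp - θq) := by module
  have hη : gradient F s - gradient F θq = t' • (gradient F θr - gradient F θq) := by
    rw [hs]
    module
  rw [bregman_add_bregman, hθ, hη, real_inner_smul_left, real_inner_smul_right, horth]
  ring
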